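/- arXiv:1005.2230 — 2 statements merged into one kernel-verified Lean document; each statement's English description precedes it below -/
import Mathlib

section
/- Let (M,ω) be an n-plectic manifold and let v₁, …, v_m (m ≥ 2) be Hamiltonian vector fields on M (i.e., each v_i is the Hamiltonian vector field of some Hamiltonian (n−1)-form). Then d ι(v₁ ∧ ⋯ ∧ v_m) ω = (−1)^m ∑_{1 ≤ i < j ≤ m} (−1)^{i+j} ι([v_i, v_j] ∧ v₁ ∧ ⋯ ∧ v̂_i ∧ ⋯ ∧ v̂_j ∧ ⋯ ∧ v_m) ω, where hats denote omitted factors and [v_i,v_j] is the Lie bracket of vector fields. -/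
open scoped Classical

/-- An abstract setting for the Cartan calculus on a smooth manifold `M`:
the points of `M`, its tangent spaces, the spaces `Ω^k(M)` of (smooth) differential
`k`-forms, the space `𝔛(M)` of (smooth) vector fields, together with the de Rham
differential `d`, interior products `ι`, the wedge product, and the Lie bracket of
vector fields, satisfying the standard identities of the Cartan calculus.
(`Form k` plays the role of `Ω^k(M)`, and `iota k : VF → Form k →ₗ Form (k-1)` is the
interior product, which vanishes on `Form 0`.) -/
structure CartanCalculus where
  /-- the points of the manifold -/
  Point : Type
  /-- the tangent space at each point -/
  Tangent : Point → Type
  [tangentAddCommGroup : ∀ x, AddCommGroup (Tangent x)]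
  [tangentModule : ∀ x, Module ℝ (Tangent x)]
  /-- the space of smooth differential `k`-forms -/
  Form : ℕ → Type
  [formAddCommGroup : ∀ k, AddCommGroup (Form k)]
  [formModule : ∀ k, Module ℝ (Form k)]
  /-- the space of smooth vector fields -/
  VF : Type
  [vfAddCommGroup : AddCommGroup VF]
  [vfModule : Module ℝ VF]
  /-- evaluation of a vector field at a point -/
  evalVF : VF →ₗ[ℝ] ((x : Point) → Tangent x)
  /-- evaluation of a `k`-form at a point, as an alternating multilinear map on the
  tangent space -/
  evalForm : (k : ℕ) → Form k →ₗ[ℝ] ((x : Point) → (Tangent x) [⋀^Fin k]→ₗ[ℝ] ℝ)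
  /-- the constant function `1 ∈ Ω^0(M) = C^∞(M)` -/
  one : Form 0
  /-- the de Rham (exterior) differential -/
  d : (k : ℕ) → Form k →ₗ[ℝ] Form (k+1)
  /-- the interior product (contraction) of a vector field with a form; it is the zero map
  on `0`-forms -/
  iota : (k : ℕ) → VF →ₗ[ℝ] Form k →ₗ[ℝ] Form (k-1)
  /-- the wedge product of forms -/
  wedge : (k l : ℕ) → Form k →ₗ[ℝ] Form l →ₗ[ℝ] Form (k+l)
  /-- the Lie bracket of vector fields -/
  bracketVF : VF →ₗ[ℝ] VF →ₗ[ℝ] VF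
  /-- vector fields are determined by their pointwise values -/
  evalVF_injective : Function.Injective evalVF
  /-- every tangent vector is the value of some (smooth) vector field -/
  evalVF_surjective : ∀ (x : Point) (v : Tangent x), ∃ X, evalVF X x = v
  /-- forms are determined by their pointwise values -/
  evalForm_injective : ∀ k, Function.Injective (evalForm k)
  evalForm_one : ∀ x, evalForm 0 one x (fun i => i.elim0) = 1
  d_one : d 0 one = 0
  d_d : ∀ (k : ℕ) (α : Form k), d (k+1) (d k α) = 0
  iota_zero : iota 0 = 0
  evalForm_iota : ∀ (k : ℕ) (X : VF) (α : Form (k+1)) (x : Point) (u : Fin k → Tangent x),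
    evalForm k (iota (k+1) X α) x u = evalForm (k+1) α x (Fin.cons (evalVF X x) u)
  evalForm_wedge : ∀ (k l : ℕ) (α : Form k) (β : Form l) (x : Point)
      (v : Fin (k+l) → Tangent x),
    evalForm (k+l) (wedge k l α β) x v
      = ((k.factorial * l.factorial : ℝ))⁻¹ *
          ∑ σ : Equiv.Perm (Fin (k+l)),
            ((Equiv.Perm.sign σ : ℤ) : ℝ) *
              (evalForm k α x (fun i => v (σ (Fin.castAdd l i))) *
               evalForm l β x (fun i => v (σ (Fin.natAdd k i))))
  d_wedge : ∀ (k l : ℕ) (α : Form k) (β : Form l),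
    d (k+l) (wedge k l α β)
      = cast (congrArg Form (by omega : (k+1)+l = (k+l)+1)) (wedge (k+1) l (d k α) β)
        + (show Form ((k+l)+1) from ((-1 : ℤ)^k) • wedge k (l+1) α (d l β))
  bracketVF_skew : ∀ X Y, bracketVF X Y = - bracketVF Y X
  bracketVF_jacobi : ∀ X Y Z,
    bracketVF X (bracketVF Y Z)
      = bracketVF (bracketVF X Y) Z + bracketVF Y (bracketVF X Z)
  /-- the Cartan commutator identity `ι_{[X,Y]} = [L_X, ι_Y]`, where
  `L_X = d ∘ ι_X + ι_X ∘ d` is the Lie derivative -/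
  iota_bracketVF : ∀ (k : ℕ) (X Y : VF) (α : Form (k+2)),
    iota (k+2) (bracketVF X Y) α
      = d k (iota (k+1) X (iota (k+2) Y α))
        + (show Form (k+1) from iota (k+2) X (d (k+1) (iota (k+2) Y α)))
        - (show Form (k+1) from iota (k+2) Y
            ((show Form (k+2) from d (k+1) (iota (k+2) X α))
              + (show Form (k+2) from iota (k+3) X (d (k+2) α))))

attribute [instance] CartanCalculus.tangentAddCommGroup CartanCalculus.tangentModule
  CartanCalculus.formAddCommGroup CartanCalculus.formModule
  CartanCalculus.vfAddCommGroup CartanCalculus.vfModule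

namespace CartanCalculus

variable (S : CartanCalculus)

/-- The de Rham differential `Ω^{k-1}(M) → Ω^k(M)`, interpreted as the zero map for
`k = 0` (i.e. `Ω^{-1}(M) = 0`). -/
def dLow : (k : ℕ) → S.Form (k-1) →ₗ[ℝ] S.Form k
  | 0 => 0
  | (r+1) => S.d r

/-- The Lie derivative of a `k`-form along a vector field, via Cartan's magic formula
`L_X = d ∘ ι_X + ι_X ∘ d`. -/
def lieD (k : ℕ) (X : S.VF) (α : S.Form k) : S.Form k :=
  S.dLow k (S.iota k X α) + (show S.Form k from S.iota (k+1) X (S.d k α))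

/-- `ω` is an `n`-plectic structure: it is a closed `(n+1)`-form which is nondegenerate,
i.e. for every point `x` and tangent vector `v` at `x`, `ι_v ω = 0` implies `v = 0`. -/
def IsPlectic (n : ℕ) (ω : S.Form (n+1)) : Prop :=
  S.d (n+1) ω = 0 ∧
    ∀ (x : S.Point) (v : S.Tangent x),
      (∀ u : Fin n → S.Tangent x, S.evalForm (n+1) ω x (Fin.cons v u) = 0) → v = 0

/-- `X` is a Hamiltonian vector field for the `(n-1)`-form `α`, i.e. `dα = -ι_X ω`.
Here and below the `n`-plectic case is parametrized as `n = m + 1`, so that the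
`n`-plectic form `ω` has degree `m + 2 = n + 1` and Hamiltonian forms have
degree `m = n - 1`. -/
def IsHamPair (m : ℕ) (ω : S.Form (m+2)) (α : S.Form m) (X : S.VF) : Prop :=
  S.d m α = - S.iota (m+2) X ω

/-- `α` is a Hamiltonian `(n-1)`-form (with `n = m+1`). -/
def IsHamiltonian (m : ℕ) (ω : S.Form (m+2)) (α : S.Form m) : Prop :=
  ∃ X, S.IsHamPair m ω α X

/-- The bracket `{α, β} = ι_{v_β} ι_{v_α} ω` of Hamiltonian `(n-1)`-forms, expressed in
terms of their Hamiltonian vector fields `X = v_α` and `Y = v_β`. -/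
def hamBracket (m : ℕ) (ω : S.Form (m+2)) (X Y : S.VF) : S.Form m :=
  S.iota (m+1) Y (S.iota (m+2) X ω)

/-- The iterated interior product `ι(v₁ ∧ ⋯ ∧ v_k) α = ι_{v_k} ⋯ ι_{v_1} α` of a
decomposable multivector field with a form. -/
def itIota (N : ℕ) : (k : ℕ) → (Fin k → S.VF) → S.Form N → S.Form (N - k)
  | 0, _, α => α
  | (k+1), v, α => S.iota (N - k) (v (Fin.last k)) (itIota N k (fun i => v i.castSucc) α)

/-- The Hamiltonian vector field of `α` (an arbitrary one when it exists; it is unique by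
nondegeneracy, and we set it to `0` when `α` is not Hamiltonian). -/
noncomputable def hamVF (m : ℕ) (ω : S.Form (m+2)) (α : S.Form m) : S.VF :=
  if h : S.IsHamiltonian m ω α then h.choose else 0

/-- The vector space of Hamiltonian `(n-1)`-forms (with `n = m+1`). -/
def hamSubmodule (m : ℕ) (ω : S.Form (m+2)) : Submodule ℝ (S.Form m) where
  carrier := {α | S.IsHamiltonian m ω α}
  zero_mem' := ⟨0, by simp [IsHamPair]⟩
  add_mem' := by
    rintro a b ⟨X, hX⟩ ⟨Y, hY⟩
    refine ⟨X + Y, ?_⟩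
    simp only [IsHamPair] at *
    simp [map_add, LinearMap.add_apply, hX, hY]
    abel
  smul_mem' := by
    rintro c a ⟨X, hX⟩
    refine ⟨c • X, ?_⟩
    simp only [IsHamPair] at *
    simp [map_smul, LinearMap.smul_apply, hX]

/-- The subspace `dΩ^{n-2}(M)` of exact `(n-1)`-forms (with `n = m+1`; for `n = 1` this
is the zero subspace). -/
def exactSubmodule (m : ℕ) : Submodule ℝ (S.Form m) :=
  LinearMap.range (S.dLow m)

section Complex

/-- The underlying space of the `n`-term complex
`C^∞(M) → Ω^1(M) → ⋯ → Ω^{n-2}(M) → Ω^{n-1}(M)` (with `n = m+1`): families of forms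
of degrees `0, …, m`.  The graded piece of (complex) degree `i` consists of those
families supported in form-degree `m - i`, and the honest complex `L` further requires
the degree-`m` form (the complex-degree-`0` component) to be Hamiltonian; see
`IsHomogeneous` and `InComplex` below. -/
def cochainSpace (m : ℕ) : Submodule ℝ ((p : ℕ) → S.Form p) where
  carrier := {f | ∀ p, m < p → f p = 0}
  zero_mem' := fun p _ => rfl
  add_mem' := by
    intro a b ha hb p hp
    show a p + b p = 0
    rw [ha p hp, hb p hp, add_zero]
  smul_mem' := by
    intro c a ha p hp
    show c • a p = 0
    rw [ha p hp, smul_zero]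

/-- An element of the complex underlying the Lie `n`-algebra. -/
abbrev Cochain (m : ℕ) := ↥(S.cochainSpace m)

/-- `x` is homogeneous of (complex) degree `i`, i.e. concentrated in form-degree `m - i`
(recall `L_i = Ω^{n-1-i}(M)` for `i > 0` and `L_0 = Ham^{n-1}(M) ⊆ Ω^{n-1}(M)`,
with `n = m+1`). -/
def IsHomogeneous (m i : ℕ) (x : S.Cochain m) : Prop :=
  i ≤ m ∧ ∀ p, p ≠ m - i → (x : (p : ℕ) → S.Form p) p = 0

/-- `x` belongs to the complex `L` (the degree-`0` component must be Hamiltonian). -/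
def InComplex (m : ℕ) (ω : S.Form (m+2)) (x : S.Cochain m) : Prop :=
  S.IsHamiltonian m ω ((x : (p : ℕ) → S.Form p) m)

/-- The element of the complex concentrated in form-degree `p₀` with value `γ`. -/
def singleCochain (m p₀ : ℕ) (hp : p₀ ≤ m) (γ : S.Form p₀) : S.Cochain m :=
  ⟨fun p => if h : p = p₀ then cast (congrArg S.Form h.symm) γ else 0,
   fun p hp' => dif_neg (by omega)⟩

/-- The differential `l₁` of the complex: the de Rham differential on components of
positive complex degree (form-degree `< m`), and `0` on the degree-`0` part. -/
def ell1 (m : ℕ) (x : S.Cochain m) : S.Cochain m :=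
  ⟨fun p => Nat.casesOn p (0 : S.Form 0)
      (fun q => if q + 1 ≤ m then S.d q ((x : (p : ℕ) → S.Form p) q) else 0),
   by
    intro p hp
    cases p with
    | zero => exact absurd hp (Nat.not_lt_zero m)
    | succ q => exact if_neg (by omega)⟩

/-- The sign `(-1)^{k/2+1}` for `k` even and `(-1)^{(k-1)/2}` for `k` odd, appearing in
the definition of the multibrackets `l_k`. -/
def signCoef (k : ℕ) : ℤ :=
  if Even k then (-1)^(k/2+1) else (-1)^((k-1)/2)

/-- The multibrackets `l_k` of the Lie `n`-algebra `L_∞(M,ω)`: `l_1` is the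
differential of the complex, and for `k ≥ 2`, `l_k` vanishes except on arguments of
(complex) degree `0`, where it is `±ι(v_{α_1} ∧ ⋯ ∧ v_{α_k}) ω` placed in
form-degree `m+2-k`, with sign given by `signCoef`. -/
noncomputable def ell (m : ℕ) (ω : S.Form (m+2)) :
    (k : ℕ) → (Fin k → S.Cochain m) → S.Cochain m
  | 0, _ => 0
  | 1, x => S.ell1 m (x 0)
  | (k+2), x =>
      S.singleCochain m (m - k) (Nat.sub_le m k)
        (signCoef (k+2) •
          cast (congrArg S.Form (by omega : m + 2 - (k+2) = m - k))
            (S.itIota (m+2) (k+2)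
              (fun i => S.hamVF m ω ((x i : (p : ℕ) → S.Form p) m)) ω))

/-- The Koszul sign `ε(σ; x_1, …, x_k)` of a permutation `σ`, where the argument `x_a`
has degree `D a`: the sign picked up from the graded commutations, not including the
sign `(-1)^σ` of the permutation. -/
def koszulSign (k : ℕ) (D : Fin k → ℕ) (σ : Equiv.Perm (Fin k)) : ℤ :=
  ∏ p ∈ Finset.univ.filter (fun p : Fin k × Fin k => p.1 < p.2 ∧ σ p.2 < σ p.1),
    (-1 : ℤ) ^ (D (σ p.1) * D (σ p.2))

/-- `σ` is an `(i, N-i)`-unshuffle: `σ(a) < σ(a+1)` whenever `a + 1 ≠ i`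
(`0`-indexed). -/
def IsUnshuffle (N i : ℕ) (σ : Equiv.Perm (Fin N)) : Prop :=
  ∀ a b : Fin N, (a : ℕ) + 1 = (b : ℕ) → (b : ℕ) ≠ i → σ a < σ b

/-- The bracket `⟦x, y⟧ = L_{v_x} y` of the differential graded Leibniz algebra: the Lie
derivative of `y` along the Hamiltonian vector field of the degree-`0` part of `x`. -/
noncomputable def leibBracket (m : ℕ) (ω : S.Form (m+2)) (x y : S.Cochain m) :
    S.Cochain m :=
  ⟨fun p => S.lieD p (S.hamVF m ω ((x : (p : ℕ) → S.Form p) m))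
      ((y : (p : ℕ) → S.Form p) p),
   by
    intro p hp
    show S.lieD p _ ((y : (p : ℕ) → S.Form p) p) = 0
    rw [y.2 p hp]
    simp [lieD]⟩

end Complex
section LowDegree

theorem sum_perm_fin_two (f : Equiv.Perm (Fin 2) → ℝ) :
    ∑ σ, f σ = f 1 + f (Equiv.swap 0 1) := by
  have h : (Finset.univ : Finset (Equiv.Perm (Fin 2))) = {1, Equiv.swap 0 1} := by decide
  rw [h, Finset.sum_insert (by decide), Finset.sum_singleton]

theorem sum_perm_fin_three (f : Equiv.Perm (Fin 3) → ℝ) :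
    ∑ σ, f σ = f 1 + f (Equiv.swap 0 1) + f (Equiv.swap 0 2) + f (Equiv.swap 1 2)
      + f (Equiv.swap 0 1 * Equiv.swap 1 2) + f (Equiv.swap 1 2 * Equiv.swap 0 1) := by
  have h : (Finset.univ : Finset (Equiv.Perm (Fin 3))) =
      {1, Equiv.swap 0 1, Equiv.swap 0 2, Equiv.swap 1 2,
        Equiv.swap 0 1 * Equiv.swap 1 2, Equiv.swap 1 2 * Equiv.swap 0 1} := by decide
  rw [h, Finset.sum_insert (by decide), Finset.sum_insert (by decide),
    Finset.sum_insert (by decide), Finset.sum_insert (by decide),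
    Finset.sum_insert (by decide), Finset.sum_singleton]
  ring

variable {S}

theorem evalForm_two_swap (β : S.Form 2) (x : S.Point) (a b : S.Tangent x) :
    S.evalForm 2 β x ![b, a] = - S.evalForm 2 β x ![a, b] := by
  have h := (S.evalForm 2 β x).map_swap ![a, b] (i := 0) (j := 1) (by decide)
  rw [← h]
  congr 1
  ext i
  fin_cases i <;> rfl

theorem evalForm_iota_one (X : S.VF) (α : S.Form 1) (x : S.Point) :
    S.evalForm 0 (S.iota 1 X α) x ![] = S.evalForm 1 α x ![S.evalVF X x] :=
  S.evalForm_iota 0 X α x ![]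

theorem evalForm_iota_two (X : S.VF) (α : S.Form 2) (x : S.Point) (u : S.Tangent x) :
    S.evalForm 1 (S.iota 2 X α) x ![u] = S.evalForm 2 α x ![S.evalVF X x, u] :=
  S.evalForm_iota 1 X α x ![u]

theorem evalForm_iota_three (X : S.VF) (α : S.Form 3) (x : S.Point) (u w : S.Tangent x) :
    S.evalForm 2 (S.iota 3 X α) x ![u, w] = S.evalForm 3 α x ![S.evalVF X x, u, w] :=
  S.evalForm_iota 2 X α x ![u, w]

theorem exists_evalForm_zero (f : S.Form 0) (x : S.Point) :
    ∃ c : ℝ, ∀ g, S.evalForm 0 f x g = c :=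
  ⟨_, fun g => congrArg _ (Subsingleton.elim g ![])⟩

theorem exists_evalForm_one (α : S.Form 1) (x : S.Point) :
    ∃ a : S.Tangent x → ℝ, ∀ g, S.evalForm 1 α x g = a (g 0) :=
  ⟨fun t => S.evalForm 1 α x ![t], fun g => congrArg _ (by ext i; fin_cases i; rfl)⟩

theorem exists_evalForm_two (β : S.Form 2) (x : S.Point) :
    ∃ b : S.Tangent x → S.Tangent x → ℝ,
      (∀ g, S.evalForm 2 β x g = b (g 0) (g 1)) ∧ ∀ s t, b t s = - b s t :=
  ⟨fun s t => S.evalForm 2 β x ![s, t],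
    fun g => congrArg _ (by ext i; fin_cases i <;> rfl), fun s t => evalForm_two_swap β x s t⟩

theorem form_zero_ext {f g : S.Form 0}
    (h : ∀ x, S.evalForm 0 f x ![] = S.evalForm 0 g x ![]) : f = g := by
  apply S.evalForm_injective 0
  funext x
  ext u
  rw [Subsingleton.elim u ![]]
  exact h x

theorem form_one_ext {α β : S.Form 1}
    (h : ∀ x u, S.evalForm 1 α x ![u] = S.evalForm 1 β x ![u]) : α = β := by
  apply S.evalForm_injective 1
  funext x
  ext u
  rw [show u = ![u 0] from by ext i; fin_cases i; rfl]
  exact h x (u 0)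

theorem evalForm_wedge_zero_zero (f g : S.Form 0) (x : S.Point) :
    S.evalForm 0 (S.wedge 0 0 f g) x ![]
      = S.evalForm 0 f x ![] * S.evalForm 0 g x ![] := by
  refine (S.evalForm_wedge 0 0 f g x ![]).trans ?_
  obtain ⟨a, ha⟩ := exists_evalForm_zero f x
  obtain ⟨b, hb⟩ := exists_evalForm_zero g x
  simp [ha, hb]

theorem evalForm_wedge_zero_one (f : S.Form 0) (α : S.Form 1) (x : S.Point)
    (u : S.Tangent x) :
    S.evalForm 1 (S.wedge 0 1 f α) x ![u]
      = S.evalForm 0 f x ![] * S.evalForm 1 α x ![u] := by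
  refine (S.evalForm_wedge 0 1 f α x ![u]).trans ?_
  obtain ⟨a, ha⟩ := exists_evalForm_zero f x
  obtain ⟨b, hb⟩ := exists_evalForm_one α x
  simp [ha, hb]

theorem evalForm_wedge_zero_two (f : S.Form 0) (β : S.Form 2) (x : S.Point)
    (u w : S.Tangent x) :
    S.evalForm 2 (S.wedge 0 2 f β) x ![u, w]
      = S.evalForm 0 f x ![] * S.evalForm 2 β x ![u, w] := by
  refine (S.evalForm_wedge 0 2 f β x ![u, w]).trans ?_
  obtain ⟨a, ha⟩ := exists_evalForm_zero f x
  obtain ⟨b, hb, hb'⟩ := exists_evalForm_two β x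
  rw [sum_perm_fin_two]
  simp [ha, hb, Fin.natAdd, Equiv.swap_apply_def]
  rw [hb' u w]
  ring

theorem evalForm_wedge_one_one (α β : S.Form 1) (x : S.Point) (u w : S.Tangent x) :
    S.evalForm 2 (S.wedge 1 1 α β) x ![u, w]
      = S.evalForm 1 α x ![u] * S.evalForm 1 β x ![w]
        - S.evalForm 1 α x ![w] * S.evalForm 1 β x ![u] := by
  refine (S.evalForm_wedge 1 1 α β x ![u, w]).trans ?_
  obtain ⟨a, ha⟩ := exists_evalForm_one α x
  obtain ⟨b, hb⟩ := exists_evalForm_one β x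
  rw [sum_perm_fin_two]
  simp [ha, hb, Fin.natAdd, Fin.castAdd, Fin.castLE]
  ring

theorem evalForm_wedge_one_two (α : S.Form 1) (β : S.Form 2) (x : S.Point)
    (u v w : S.Tangent x) :
    S.evalForm 3 (S.wedge 1 2 α β) x ![u, v, w]
      = S.evalForm 1 α x ![u] * S.evalForm 2 β x ![v, w]
        - S.evalForm 1 α x ![v] * S.evalForm 2 β x ![u, w]
        + S.evalForm 1 α x ![w] * S.evalForm 2 β x ![u, v] := by
  refine (S.evalForm_wedge 1 2 α β x ![u, v, w]).trans ?_
  obtain ⟨a, ha⟩ := exists_evalForm_one α x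
  obtain ⟨b, hb, hb'⟩ := exists_evalForm_two β x
  rw [sum_perm_fin_three]
  simp [ha, hb, Fin.natAdd, Fin.castAdd, Fin.castLE, Equiv.swap_apply_def]
  rw [hb' u v, hb' u w, hb' v w]
  ring

theorem evalForm_wedge_two_one (β : S.Form 2) (α : S.Form 1) (x : S.Point)
    (u v w : S.Tangent x) :
    S.evalForm 3 (S.wedge 2 1 β α) x ![u, v, w]
      = S.evalForm 1 α x ![u] * S.evalForm 2 β x ![v, w]
        - S.evalForm 1 α x ![v] * S.evalForm 2 β x ![u, w]
        + S.evalForm 1 α x ![w] * S.evalForm 2 β x ![u, v] := by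
  refine (S.evalForm_wedge 2 1 β α x ![u, v, w]).trans ?_
  obtain ⟨a, ha⟩ := exists_evalForm_one α x
  obtain ⟨b, hb, hb'⟩ := exists_evalForm_two β x
  rw [sum_perm_fin_three]
  simp [ha, hb, Fin.natAdd, Fin.castAdd, Fin.castLE, Equiv.swap_apply_def]
  rw [hb' u v, hb' u w, hb' v w]
  ring

theorem evalForm_wedge_one_zero (α : S.Form 1) (f : S.Form 0) (x : S.Point)
    (u : S.Tangent x) :
    S.evalForm 1 (S.wedge 1 0 α f) x ![u]
      = S.evalForm 1 α x ![u] * S.evalForm 0 f x ![] := by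
  refine (S.evalForm_wedge 1 0 α f x ![u]).trans ?_
  obtain ⟨a, ha⟩ := exists_evalForm_zero f x
  obtain ⟨b, hb⟩ := exists_evalForm_one α x
  simp [ha, hb]

theorem evalForm_d_wedge_zero_zero (f g : S.Form 0) (x : S.Point) (u : S.Tangent x) :
    S.evalForm 1 (S.d 0 (S.wedge 0 0 f g)) x ![u]
      = S.evalForm 1 (S.d 0 f) x ![u] * S.evalForm 0 g x ![]
        + S.evalForm 0 f x ![] * S.evalForm 1 (S.d 0 g) x ![u] := by
  have h : S.d 0 (S.wedge 0 0 f g)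
      = (show S.Form 1 from S.wedge 1 0 (S.d 0 f) g)
        + (show S.Form 1 from S.wedge 0 1 f (S.d 0 g)) :=
    (S.d_wedge 0 0 f g).trans (congrArg _ (one_smul ℤ _))
  rw [h, map_add, Pi.add_apply, AlternatingMap.add_apply]
  exact congrArg₂ _ (evalForm_wedge_one_zero _ _ _ _) (evalForm_wedge_zero_one _ _ _ _)

theorem evalForm_d_wedge_zero_one (f : S.Form 0) (α : S.Form 1) (x : S.Point)
    (u w : S.Tangent x) :
    S.evalForm 2 (S.d 1 (S.wedge 0 1 f α)) x ![u, w]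
      = S.evalForm 1 (S.d 0 f) x ![u] * S.evalForm 1 α x ![w]
        - S.evalForm 1 (S.d 0 f) x ![w] * S.evalForm 1 α x ![u]
        + S.evalForm 0 f x ![] * S.evalForm 2 (S.d 1 α) x ![u, w] := by
  have h : S.d 1 (S.wedge 0 1 f α)
      = S.wedge 1 1 (S.d 0 f) α + (show S.Form 2 from S.wedge 0 2 f (S.d 1 α)) :=
    (S.d_wedge 0 1 f α).trans (congrArg _ (one_smul ℤ _))
  rw [h, map_add, Pi.add_apply, AlternatingMap.add_apply, evalForm_wedge_one_one,
    evalForm_wedge_zero_two]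

theorem evalForm_d_wedge_one_one (α β : S.Form 1) (x : S.Point)
    (u v w : S.Tangent x) :
    S.evalForm 3 (S.d 2 (S.wedge 1 1 α β)) x ![u, v, w]
      = S.evalForm 3 (S.wedge 2 1 (S.d 1 α) β) x ![u, v, w]
        - S.evalForm 3 (S.wedge 1 2 α (S.d 1 β)) x ![u, v, w] := by
  have h : S.d 2 (S.wedge 1 1 α β)
      = S.wedge 2 1 (S.d 1 α) β + (show S.Form 3 from -S.wedge 1 2 α (S.d 1 β)) :=
    (S.d_wedge 1 1 α β).trans (congrArg _ (neg_one_smul ℤ _))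
  rw [h, map_add, Pi.add_apply, AlternatingMap.add_apply]
  simp [sub_eq_add_neg]

theorem iota_wedge_one_one (Y : S.VF) (α β : S.Form 1) :
    S.iota 2 Y (S.wedge 1 1 α β)
      = (show S.Form 1 from S.wedge 0 1 (S.iota 1 Y α) β)
        - (show S.Form 1 from S.wedge 0 1 (S.iota 1 Y β) α) := by
  refine form_one_ext fun x u => ?_
  rw [map_sub, Pi.sub_apply, AlternatingMap.sub_apply]
  refine (evalForm_iota_two Y _ x u).trans ?_
  rw [evalForm_wedge_one_one]
  refine Eq.trans ?_ (congrArg₂ _ (evalForm_wedge_zero_one _ _ _ _).symm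
    (evalForm_wedge_zero_one _ _ _ _).symm)
  rw [evalForm_iota_one, evalForm_iota_one]
  ring

theorem iota_wedge_zero_one (X : S.VF) (f : S.Form 0) (α : S.Form 1) :
    S.iota 1 X (S.wedge 0 1 f α) = S.wedge 0 0 f (S.iota 1 X α) := by
  refine form_zero_ext fun x => ?_
  refine (evalForm_iota_one X _ x).trans ?_
  refine (evalForm_wedge_zero_one _ _ _ _).trans ?_
  refine Eq.trans ?_ (evalForm_wedge_zero_zero _ _ _).symm
  rw [evalForm_iota_one]

/-- The failure of `ι_{[X,Y]} = L_X ι_Y - ι_Y L_X` on a `1`-form, evaluated at a point. -/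
def commDefect (X Y : S.VF) (α : S.Form 1) (x : S.Point) : ℝ :=
  S.evalForm 1 α x ![S.evalVF (S.bracketVF X Y) x]
    - S.evalForm 1 (S.d 0 (S.iota 1 Y α)) x ![S.evalVF X x]
    + S.evalForm 1 (S.d 0 (S.iota 1 X α)) x ![S.evalVF Y x]
    + S.evalForm 2 (S.d 1 α) x ![S.evalVF X x, S.evalVF Y x]

theorem commDefect_mul (X Y : S.VF) (α β : S.Form 1) (x : S.Point) (u : S.Tangent x) :
    commDefect X Y α x * S.evalForm 1 β x ![u]
      = commDefect X Y β x * S.evalForm 1 α x ![u] := by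
  have h := congrArg (fun γ => S.evalForm 1 γ x ![u])
    (S.iota_bracketVF 0 X Y (S.wedge 1 1 α β))
  have key : S.evalForm 2 (S.wedge 1 1 α β) x ![S.evalVF (S.bracketVF X Y) x, u]
      = S.evalForm 1 (S.d 0 (S.iota 1 X (S.iota 2 Y (S.wedge 1 1 α β)))) x ![u]
        + S.evalForm 2 (S.d 1 (S.iota 2 Y (S.wedge 1 1 α β))) x ![S.evalVF X x, u]
        - (S.evalForm 2 (S.d 1 (S.iota 2 X (S.wedge 1 1 α β))) x ![S.evalVF Y x, u]
          + S.evalForm 3 (S.d 2 (S.wedge 1 1 α β)) x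
              ![S.evalVF X x, S.evalVF Y x, u]) := by
    rw [← evalForm_iota_two, ← evalForm_iota_two, ← evalForm_iota_two,
      ← evalForm_iota_three, ← evalForm_iota_two]
    refine h.trans ?_
    simp only [map_sub, map_add, Pi.add_apply, Pi.sub_apply, AlternatingMap.add_apply,
      AlternatingMap.sub_apply]
  rw [iota_wedge_one_one, iota_wedge_one_one] at key
  simp only [map_sub, Pi.sub_apply, AlternatingMap.sub_apply] at key
  erw [iota_wedge_zero_one, iota_wedge_zero_one] at key
  simp only [evalForm_d_wedge_zero_zero, evalForm_d_wedge_zero_one,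
    evalForm_d_wedge_one_one, evalForm_wedge_one_one, evalForm_wedge_two_one,
    evalForm_wedge_one_two, evalForm_iota_one] at key
  unfold commDefect
  linear_combination key

end LowDegree

section Commutator

variable {S}

theorem exists_contraction_to_one_form (k : ℕ) (ω : S.Form (k+1)) (x : S.Point)
    (z : Fin k → S.Tangent x) :
    ∃ α : S.Form 1, ∀ u, S.evalForm 1 α x ![u]
      = S.evalForm (k+1) ω x (Fin.snoc (α := fun _ => S.Tangent x) z u) := by
  induction k with
  | zero =>
    refine ⟨ω, fun u => congrArg _ ?_⟩
    ext i
    fin_cases i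
    rfl
  | succ k ih =>
    obtain ⟨Y, hY⟩ := S.evalVF_surjective x (z 0)
    obtain ⟨α, hα⟩ := ih (S.iota (k+2) Y ω) (fun i => z i.succ)
    refine ⟨α, fun u => ?_⟩
    rw [hα]
    refine (S.evalForm_iota (k+1) Y ω x _).trans ?_
    rw [hY]
    congr 1
    refine (Fin.cons_snoc_eq_snoc_cons (z 0) _ u).trans ?_
    congr 1
    exact Fin.cons_self_tail z

theorem commDefect_eq_zero {μ : ℕ} {ω : S.Form (μ+2)} (hω : S.IsPlectic (μ+1) ω)
    (X Y : S.VF) (α : S.Form 1) (x : S.Point) : commDefect X Y α x = 0 := by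
  by_contra hc
  have eq_zero_of_ker : ∀ u, S.evalForm 1 α x ![u] = 0 → u = 0 := by
    intro u hu
    refine hω.2 x u fun z => ?_
    obtain ⟨γ, hγ⟩ := exists_contraction_to_one_form (μ+1) ω x z
    have hγu : S.evalForm 1 γ x ![u] = 0 := by
      have h := commDefect_mul X Y α γ x u
      rw [hu, mul_zero] at h
      exact (mul_eq_zero.mp h).resolve_left hc
    rw [hγ, Fin.snoc_eq_cons_rotate] at hγu
    have hperm := (S.evalForm (μ+2) ω x).map_perm
      (Fin.cons (α := fun _ => S.Tangent x) u z) (finRotate (μ+2))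
    have h0 := hperm.symm.trans hγu
    rcases Int.units_eq_one_or (Equiv.Perm.sign (finRotate (μ+2))) with hs | hs <;>
      rw [hs] at h0 <;> simpa using h0
  have tangent_eq_zero : ∀ u : S.Tangent x, u = 0 := by
    intro u
    refine hω.2 x u fun z => ?_
    refine AlternatingMap.map_linearDependent _ _ fun hli => ?_
    have h01 := hli.comp ![(0 : Fin (μ+2)), 1] (by
      intro i j; fin_cases i <;> fin_cases j <;> simp)
    have hpair : S.evalForm 1 α x ![z 0] • u + (-S.evalForm 1 α x ![u]) • z 0 = 0 := by
      apply eq_zero_of_ker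
      have hlin : ∀ (a b : ℝ) (s t : S.Tangent x), S.evalForm 1 α x ![a • s + b • t]
          = a * S.evalForm 1 α x ![s] + b * S.evalForm 1 α x ![t] := by
        intro a b s t
        have hadd := (S.evalForm 1 α x).map_update_add ![0] 0 (a • s) (b • t)
        have h1 := (S.evalForm 1 α x).map_update_smul ![0] 0 a s
        have h2 := (S.evalForm 1 α x).map_update_smul ![0] 0 b t
        have hupd : ∀ w : S.Tangent x, Function.update ![0] (0 : Fin 1) w = ![w] := by
          intro w; ext i; fin_cases i; rfl
        rw [h1, h2] at hadd
        simpa only [hupd, smul_eq_mul] using hadd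
      rw [hlin]
      ring
    have hu : S.evalForm 1 α x ![u] = 0 := by
      have h := Fintype.linearIndependent_iff.mp h01
        ![S.evalForm 1 α x ![z 0], -S.evalForm 1 α x ![u]] (by
          rw [Fin.sum_univ_two]; exact hpair) 1
      simpa using h
    exact hli.ne_zero 0 (eq_zero_of_ker u hu)
  apply hc
  have h1 : ∀ (γ : S.Form 1) (u : S.Tangent x), S.evalForm 1 γ x ![u] = 0 := fun γ u =>
    (S.evalForm 1 γ x).map_coord_zero 0 (tangent_eq_zero _)
  have h2 : ∀ (γ : S.Form 2) (u w : S.Tangent x), S.evalForm 2 γ x ![u, w] = 0 :=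
    fun γ u w => (S.evalForm 2 γ x).map_coord_zero 0 (tangent_eq_zero _)
  simp [commDefect, h1, h2]

/-- The Cartan commutator identity `ι_{[X,Y]} = L_X ι_Y - ι_Y L_X` in every degree, on a
manifold carrying a nondegenerate form. -/
theorem iota_bracketVF_eq_lieD {μ : ℕ} {ω : S.Form (μ+2)} (hω : S.IsPlectic (μ+1) ω)
    (k : ℕ) (X Y : S.VF) (α : S.Form k) :
    S.iota k (S.bracketVF X Y) α
      = S.lieD (k-1) X (S.iota k Y α) - S.iota k Y (S.lieD k X α) := by
  match k, α with
  | 0, α => simp [S.iota_zero, lieD]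
  | 1, α =>
    refine form_zero_ext fun x => ?_
    have hD := commDefect_eq_zero hω X Y α x
    have e : S.lieD (1-1) X (S.iota 1 Y α) = S.iota 1 X (S.d 0 (S.iota 1 Y α)) := by
      simp [lieD, dLow]
    have e' : S.lieD 1 X α
        = S.d 0 (S.iota 1 X α) + (show S.Form 1 from S.iota 2 X (S.d 1 α)) := rfl
    rw [e, e', map_sub, map_add, map_add, Pi.sub_apply, Pi.add_apply,
      AlternatingMap.sub_apply, AlternatingMap.add_apply]
    simp only [evalForm_iota_one, evalForm_iota_two]
    unfold commDefect at hD
    linear_combination hD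
  | k+2, α => exact S.iota_bracketVF k X Y α

end Commutator

section IteratedContraction

variable {S}

theorem iota_iota_swap (k : ℕ) (X Y : S.VF) (α : S.Form k) :
    S.iota (k-1) X (S.iota k Y α) = - S.iota (k-1) Y (S.iota k X α) := by
  match k, α with
  | 0, α => simp [S.iota_zero]
  | 1, α => simp [S.iota_zero]
  | k+2, α =>
    apply S.evalForm_injective k
    funext x
    ext u
    rw [map_neg]
    have h : ∀ X Y : S.VF, S.evalForm k (S.iota (k+1) X (S.iota (k+2) Y α)) x u
        = S.evalForm (k+2) α x (Fin.cons (S.evalVF Y x) (Fin.cons (S.evalVF X x) u)) :=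
      fun X Y => (S.evalForm_iota k X _ x u).trans (S.evalForm_iota (k+1) Y α x _)
    refine (h X Y).trans (Eq.trans ?_ (congrArg Neg.neg (h Y X)).symm)
    rw [← (S.evalForm (k+2) α x).map_swap _ (i := 0) (j := 1) (by simp)]
    congr 1
    ext i
    refine Fin.cases ?_ (fun i => Fin.cases ?_ (fun i => ?_) i) i
    · simp
    · simp
    · rw [Function.comp_apply, Equiv.swap_apply_of_ne_of_ne
        (Fin.succ_ne_zero _) (by simp [Fin.ext_iff])]
      rfl

theorem itIota_zero (N k : ℕ) (v : Fin k → S.VF) : S.itIota N k v 0 = 0 := by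
  induction k with
  | zero => rfl
  | succ k ih => simp [itIota, ih]

theorem itIota_eq_zero_of_lt (N k : ℕ) (hk : N < k) (v : Fin k → S.VF) (ω : S.Form N) :
    S.itIota N k v ω = 0 := by
  obtain ⟨k, rfl⟩ : ∃ l, k = l + 1 := ⟨k - 1, by omega⟩
  have h : ∀ (p : ℕ) (X : S.VF) (α : S.Form p), p = 0 → S.iota p X α = 0 := by
    rintro p X α rfl
    simp [S.iota_zero]
  exact h _ _ _ (by omega)

theorem castSucc_succAbove_last {n : ℕ} (i : Fin (n+1)) :
    i.castSucc.succAbove (Fin.last n) = Fin.last (n+1) :=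
  Fin.succAbove_ne_last_last (Fin.castSucc_lt_last i).ne

theorem itIota_cons_succ (N k : ℕ) (w : S.VF) (u : Fin (k+1) → S.VF) (ω : S.Form N) :
    S.itIota N (k+2) (Fin.cons w u) ω
      = S.iota (N-(k+1)) (u (Fin.last k))
          (S.itIota N (k+1) (Fin.cons w (fun t => u t.castSucc)) ω) := by
  have h : (fun t : Fin (k+1) => (Fin.cons w u : Fin (k+2) → S.VF) t.castSucc)
      = Fin.cons w (fun t => u t.castSucc) := by
    funext t
    refine Fin.cases rfl (fun t => rfl) t
  rw [← h]
  rfl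

theorem itIota_cons_neg (N k : ℕ) (w : S.VF) (u : Fin k → S.VF) (ω : S.Form N) :
    S.itIota N (k+1) (Fin.cons (-w) u) ω = - S.itIota N (k+1) (Fin.cons w u) ω := by
  induction k with
  | zero => simp [itIota]
  | succ k ih => rw [itIota_cons_succ, itIota_cons_succ, ih, map_neg]

theorem itIota_move_to_front (N k : ℕ) (v : Fin (k+1) → S.VF) (i : Fin (k+1))
    (ω : S.Form N) :
    S.itIota N (k+1) v ω = ((-1 : ℤ)^(i : ℕ)) •
      S.itIota N (k+1) (Fin.cons (v i) (fun t => v (i.succAbove t))) ω := by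
  induction k with
  | zero =>
    obtain rfl : i = 0 := Fin.fin_one_eq_zero i
    simp only [itIota]
    simp
  | succ k ih =>
    rw [itIota_cons_succ]
    induction i using Fin.lastCases with
    | cast i =>
      have h := ih (fun t => v t.castSucc) i
      change S.iota (N-(k+1)) (v (Fin.last (k+1)))
        (S.itIota N (k+1) (fun t => v t.castSucc) ω) = _
      rw [h, map_zsmul]
      simp only [Fin.castSucc_succAbove_castSucc,
        castSucc_succAbove_last, Fin.val_castSucc]
    | last =>
      have h := ih (fun t => v ((Fin.last k).castSucc.succAbove t)) (Fin.last k)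
      have h' : S.itIota N (k+1) (fun t => v ((Fin.last k).castSucc.succAbove t)) ω
          = S.iota (N-k) (v (Fin.last (k+1)))
              (S.itIota N k (fun t => v t.castSucc.castSucc) ω) := by
        simp only [itIota, castSucc_succAbove_last, Fin.castSucc_succAbove_castSucc,
          Fin.succAbove_last]
      change S.iota (N-k-1) (v (Fin.last (k+1))) (S.iota (N-k) (v (Fin.last k).castSucc)
        (S.itIota N k (fun t => v t.castSucc.castSucc) ω)) = _
      rw [iota_iota_swap, ← h', h, map_zsmul]
      simp only [castSucc_succAbove_last, Fin.castSucc_succAbove_castSucc,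
          Fin.succAbove_last, Fin.val_last, pow_succ, mul_neg, mul_one, neg_smul]
      rfl

theorem lieD_itIota {μ : ℕ} {ω : S.Form (μ+2)} (hω : S.IsPlectic (μ+1) ω)
    (N k : ℕ) (X : S.VF) (v : Fin k → S.VF) (α : S.Form N) :
    S.lieD (N-k) X (S.itIota N k v α)
      = ∑ i, S.itIota N k (Function.update v i (S.bracketVF X (v i))) α
        + S.itIota N k v (S.lieD N X α) := by
  induction k with
  | zero => simp [itIota]
  | succ k ih =>
    have hcomm := iota_bracketVF_eq_lieD hω (N-k) X (v (Fin.last k))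
      (S.itIota N k (fun i => v i.castSucc) α)
    rw [ih, map_add, map_sum] at hcomm
    have hstep : S.lieD (N-(k+1)) X (S.itIota N (k+1) v α)
        = S.iota (N-k) (S.bracketVF X (v (Fin.last k)))
            (S.itIota N k (fun i => v i.castSucc) α)
          + (∑ i, S.iota (N-k) (v (Fin.last k)) (S.itIota N k
              (Function.update (fun i => v i.castSucc) i (S.bracketVF X (v i.castSucc))) α)
            + S.iota (N-k) (v (Fin.last k))
                (S.itIota N k (fun i => v i.castSucc) (S.lieD N X α))) :=
      sub_eq_iff_eq_add.mp hcomm.symm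
    rw [hstep, Fin.sum_univ_castSucc]
    have hcast : ∀ i : Fin k, S.itIota N (k+1)
        (Function.update v i.castSucc (S.bracketVF X (v i.castSucc))) α
        = S.iota (N-k) (v (Fin.last k)) (S.itIota N k
            (Function.update (fun i => v i.castSucc) i (S.bracketVF X (v i.castSucc))) α) := by
      intro i
      have hu : (fun t : Fin k => Function.update v i.castSucc
          (S.bracketVF X (v i.castSucc)) t.castSucc)
          = Function.update (fun i => v i.castSucc) i (S.bracketVF X (v i.castSucc)) := by
        funext t
        simp [Function.update_apply]
      rw [← hu, itIota, Function.update_of_ne (Fin.castSucc_lt_last i).ne']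
    have hlast : S.itIota N (k+1)
        (Function.update v (Fin.last k) (S.bracketVF X (v (Fin.last k)))) α
        = S.iota (N-k) (S.bracketVF X (v (Fin.last k)))
            (S.itIota N k (fun i => v i.castSucc) α) := by
      simp only [itIota, Function.update_self]
      congr 2
      funext t
      exact Function.update_of_ne (Fin.castSucc_lt_last t).ne _ _
    simp only [hcast, hlast]
    change _ = _ + S.iota (N-k) (v (Fin.last k))
      (S.itIota N k (fun i => v i.castSucc) (S.lieD N X α))
    abel

theorem dLow_iota (p : ℕ) (X : S.VF) (α : S.Form (p-1)) (hα : p = 0 → α = 0) :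
    S.dLow (p-1) (S.iota (p-1) X α) = S.lieD (p-1) X α - S.iota p X (S.dLow p α) := by
  match p, α, hα with
  | 0, α, hα => simp [hα rfl, lieD]
  | p+1, α, _ => exact eq_sub_of_add_eq rfl

theorem dLow_itIota_succ {μ : ℕ} {ω : S.Form (μ+2)} (hω : S.IsPlectic (μ+1) ω)
    (k : ℕ) (v : Fin (k+2) → S.VF)
    (hv : S.lieD (μ+2) (v (Fin.last (k+1))) ω = 0) :
    S.dLow (μ+2-(k+1)) (S.itIota (μ+2) (k+2) v ω)
      = ∑ i : Fin (k+1), (-(-1 : ℤ)^(i : ℕ)) • S.itIota (μ+2) (k+1)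
          (Fin.cons (S.bracketVF (v i.castSucc) (v (Fin.last (k+1))))
            (fun t => v (i.succAbove t).castSucc)) ω
        - S.iota (μ+2-k) (v (Fin.last (k+1)))
            (S.dLow (μ+2-k) (S.itIota (μ+2) (k+1) (fun i => v i.castSucc) ω)) := by
  have hd := dLow_iota (μ+2-k) (v (Fin.last (k+1)))
    (S.itIota (μ+2) (k+1) (fun i => v i.castSucc) ω)
    (fun h => itIota_eq_zero_of_lt _ _ (by omega) _ _)
  have hL := lieD_itIota hω (μ+2) (k+1) (v (Fin.last (k+1))) (fun i => v i.castSucc) ω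
  rw [hv, itIota_zero, add_zero] at hL
  refine hd.trans ?_
  refine (congrArg (· - _) hL).trans ?_
  refine congrArg (· - _) (Finset.sum_congr rfl fun i _ => ?_)
  rw [itIota_move_to_front _ _ _ i]
  simp only [Function.update_self, ne_eq, Fin.succAbove_ne, not_false_eq_true,
    Function.update_of_ne]
  rw [S.bracketVF_skew, itIota_cons_neg, smul_neg, neg_smul]

theorem d_iota_eq_zero {μ : ℕ} {ω : S.Form (μ+2)} {X : S.VF}
    (hX : ∃ α : S.Form μ, S.IsHamPair μ ω α X) : S.d (μ+1) (S.iota (μ+2) X ω) = 0 := by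
  obtain ⟨α, hα⟩ := hX
  have h := S.d_d μ α
  rwa [hα, map_neg, neg_eq_zero] at h

theorem lieD_eq_zero {μ : ℕ} {ω : S.Form (μ+2)} (hω : S.IsPlectic (μ+1) ω)
    {X : S.VF} (hX : ∃ α : S.Form μ, S.IsHamPair μ ω α X) : S.lieD (μ+2) X ω = 0 := by
  have h' : S.iota (μ+3) X (S.d (μ+2) ω) = 0 := by
    rw [hω.1, map_zero]
  change S.d (μ+1) (S.iota (μ+2) X ω)
    + (show S.Form (μ+2) from S.iota (μ+3) X (S.d (μ+2) ω)) = 0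
  rw [d_iota_eq_zero hX, zero_add]
  exact h'

end IteratedContraction

/-- Let `(M, ω)` be an `n`-plectic manifold (here `n = μ + 1`) and let
`v₁, …, v_k` with `k = j + 2 ≥ 2` be Hamiltonian vector fields on `M`.  Then
`d ι(v₁ ∧ ⋯ ∧ v_k) ω
   = (-1)^k ∑_{a < b} (-1)^{a+b} ι([v_a, v_b] ∧ v₁ ∧ ⋯ v̂_a ⋯ v̂_b ⋯ ∧ v_k) ω`,
where hats denote omitted factors (the omissions are implemented by
`Fin.succAbove`), the sign `(-1)^{a+b}` is written `0`-indexed (which agrees with the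
`1`-indexed convention since `(a+1)+(b+1) ≡ a+b mod 2`), and the exterior derivative
on the left is `dLow` (the de Rham differential, interpreted as `0` out of
form-degree `-1`, which occurs only when `k > n + 1`). -/
theorem d_itIota_eq_sum_brackets
    (μ : ℕ) (ω : S.Form (μ+2)) (hω : S.IsPlectic (μ+1) ω)
    (j : ℕ) (v : Fin (j+2) → S.VF)
    (hv : ∀ i, ∃ α : S.Form μ, S.IsHamPair μ ω α (v i)) :
    S.dLow (μ+2-(j+1)) (show S.Form (μ+2-(j+1)-1) from S.itIota (μ+2) (j+2) v ω)
      = ((-1 : ℤ)^(j+2)) •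
          ∑ a : Fin (j+2), ∑ b : Fin (j+2),
            if h : a < b then
              ((-1 : ℤ)^((a : ℕ)+(b : ℕ))) •
                S.itIota (μ+2) (j+1)
                  (Fin.cons (S.bracketVF (v a) (v b))
                    (fun t : Fin j =>
                      v (a.succAbove
                          ((⟨(b : ℕ) - 1, by have := b.isLt; omega⟩ :
                              Fin (j+1)).succAbove t)))) ω
            else 0 := by
  induction j with
  | zero =>
    refine (dLow_itIota_succ hω 0 v (lieD_eq_zero hω (hv _))).trans ?_
    have hd : S.dLow (μ+2) (S.itIota (μ+2) 1 (fun i => v i.castSucc) ω) = 0 :=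
      d_iota_eq_zero (hv _)
    refine (congrArg (fun γ => _ - S.iota (μ+2) (v 1) γ) hd).trans ?_
    simp [Fin.sum_univ_two, itIota]
  | succ j ih =>
    refine (dLow_itIota_succ hω (j+1) v (lieD_eq_zero hω (hv _))).trans ?_
    have hd := ih (fun i => v i.castSucc) (fun i => hv _)
    refine (congrArg (fun γ => _ - S.iota (μ+2-(j+1)) (v (Fin.last (j+2))) γ) hd).trans ?_
    rw [Fin.sum_univ_castSucc (n := j+2)]
    have hlast : ∀ b : Fin (j+3), ¬ Fin.last (j+2) < b := fun b => (Fin.le_last b).not_gt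
    simp only [hlast, dite_false, Finset.sum_const_zero, add_zero]
    simp only [Fin.sum_univ_castSucc (n := j+2)]
    rw [Finset.sum_add_distrib, smul_add, sub_eq_add_neg]
    refine Eq.trans (congrArg₂ (· + ·) ?_ ?_) (add_comm _ _)
    · rw [Finset.smul_sum]
      refine Finset.sum_congr rfl fun a _ => ?_
      rw [dif_pos (Fin.castSucc_lt_last a), smul_smul]
      have hsign : (-1 : ℤ)^(j+1+2) * (-1)^((a.castSucc : ℕ) + (Fin.last (j+2) : ℕ))
          = -(-1)^(a : ℕ) := by
        rw [← pow_add, Fin.val_castSucc, Fin.val_last,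
          show j+1+2+((a : ℕ)+(j+2)) = 2*(j+2)+1+a by ring, pow_add, pow_succ, pow_mul]
        simp
      rw [hsign]
      congr 3
      funext t
      have hidx : (⟨((Fin.last (j+2) : Fin (j+3)) : ℕ) - 1, by simp⟩ : Fin (j+2))
          = Fin.last (j+1) := rfl
      rw [hidx, Fin.succAbove_last, Fin.castSucc_succAbove_castSucc]
    · rw [map_zsmul, ← neg_smul, pow_succ (-1 : ℤ) (j+2), mul_neg_one, map_sum]
      refine congrArg _ (Finset.sum_congr rfl fun a _ => ?_)
      rw [map_sum]
      refine Finset.sum_congr rfl fun b _ => ?_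
      by_cases hab : a < b
      · rw [dif_pos hab, dif_pos (Fin.castSucc_lt_castSucc_iff.mpr hab), map_zsmul,
          itIota_cons_succ]
        have hidx : (⟨(b.castSucc : ℕ) - 1, by simp; omega⟩ : Fin (j+2))
          = Fin.castSucc ⟨(b : ℕ) - 1, by omega⟩ := rfl
        rw [hidx]
        simp only [castSucc_succAbove_last, Fin.castSucc_succAbove_castSucc]
        rfl
      · rw [dif_neg hab, dif_neg (mt Fin.castSucc_lt_castSucc_iff.mp hab), map_zero]

end CartanCalculus
end

section
/- Let (M,ω) be an n-plectic manifold. The bracket {α,β} = ι_{v_β} ι_{v_α} ω on Hamiltonian (n−1)-forms induces a well-defined skew-symmetric bracket {·,·}′ on the quotient vector space 𝔤 = Ham^{n−1}(M) / dΩ^{n−2}(M) of Hamiltonian (n−1)-forms modulo exact (n−1)-forms, and (𝔤, {·,·}′) is a Lie algebra (the induced bracket satisfies the Jacobi identity). -/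
open scoped Classical

namespace CartanCalculus

variable (S : CartanCalculus)

section Contraction

/-- The interior product `Ω^{k+1}(M) → Ω^k(M)`, with its target in normal form. -/
def contr (k : ℕ) : S.VF →ₗ[ℝ] S.Form (k+1) →ₗ[ℝ] S.Form k := S.iota (k+1)

variable {S}

theorem form_ext {k : ℕ} {α β : S.Form k}
    (h : ∀ x u, S.evalForm k α x u = S.evalForm k β x u) : α = β :=
  S.evalForm_injective k (funext fun x => AlternatingMap.ext fun u => h x u)

theorem evalForm_contr (k : ℕ) (X : S.VF) (α : S.Form (k+1)) (x : S.Point)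
    (u : Fin k → S.Tangent x) :
    S.evalForm k (S.contr k X α) x u = S.evalForm (k+1) α x (Fin.cons (S.evalVF X x) u) :=
  S.evalForm_iota k X α x u

theorem contr_contr_self (k : ℕ) (X : S.VF) (α : S.Form (k+2)) :
    S.contr k X (S.contr (k+1) X α) = 0 := by
  refine form_ext fun x u => ?_
  rw [evalForm_contr, evalForm_contr, map_zero, Pi.zero_apply, AlternatingMap.zero_apply]
  exact AlternatingMap.map_eq_zero_of_eq _ _ (i := 0) (j := 1) (by simp [Fin.cons_one]) (by simp)

theorem contr_contr_comm (k : ℕ) (X Y : S.VF) (α : S.Form (k+2)) :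
    S.contr k X (S.contr (k+1) Y α) = - S.contr k Y (S.contr (k+1) X α) := by
  have h := contr_contr_self k (X + Y) α
  simp only [map_add, LinearMap.add_apply, contr_contr_self, zero_add, add_zero] at h
  exact eq_neg_of_add_eq_zero_right h

theorem contr_bracketVF (k : ℕ) (X Y : S.VF) (α : S.Form (k+2)) :
    S.contr (k+1) (S.bracketVF X Y) α
      = S.d k (S.contr k X (S.contr (k+1) Y α))
        + S.contr (k+1) X (S.d (k+1) (S.contr (k+1) Y α))
        - S.contr (k+1) Y
            (S.d (k+1) (S.contr (k+1) X α) + S.contr (k+2) X (S.d (k+2) α)) :=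
  S.iota_bracketVF k X Y α

theorem evalForm_contr_eq_zero {k : ℕ} {X : S.VF} {x : S.Point} (hX : S.evalVF X x = 0)
    (α : S.Form (k+1)) : S.evalForm k (S.contr k X α) x = 0 := by
  ext u
  rw [evalForm_contr, AlternatingMap.zero_apply]
  exact AlternatingMap.map_coord_zero _ 0 (by simpa using hX)

end Contraction

section LowDegree

/-- The product of functions. -/
def funMul : S.Form 0 →ₗ[ℝ] S.Form 0 →ₗ[ℝ] S.Form 0 := S.wedge 0 0

/-- The product of a function and a `1`-form. -/
def funSmul : S.Form 0 →ₗ[ℝ] S.Form 1 →ₗ[ℝ] S.Form 1 := S.wedge 0 1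

/-- The wedge product of two `1`-forms. -/
def wedgeOne : S.Form 1 →ₗ[ℝ] S.Form 1 →ₗ[ℝ] S.Form 2 := S.wedge 1 1

variable {S}

theorem evalForm_zero_eq (f : S.Form 0) (x : S.Point) (u : Fin 0 → S.Tangent x) :
    S.evalForm 0 f x u = S.evalForm 0 f x Fin.elim0 := by
  rw [Subsingleton.elim u Fin.elim0]

theorem evalForm_fun_mul (f g : S.Form 0) (x : S.Point) (u : Fin 0 → S.Tangent x) :
    S.evalForm 0 (S.funMul f g) x u
      = S.evalForm 0 f x Fin.elim0 * S.evalForm 0 g x Fin.elim0 := by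
  refine (S.evalForm_wedge 0 0 f g x u).trans ?_
  simp [evalForm_zero_eq]

theorem evalForm_fun_smul (f : S.Form 0) (a : S.Form 1) (x : S.Point)
    (u : Fin 1 → S.Tangent x) :
    S.evalForm 1 (S.funSmul f a) x u = S.evalForm 0 f x Fin.elim0 * S.evalForm 1 a x u := by
  refine (S.evalForm_wedge 0 1 f a x u).trans ?_
  have h : ∀ i : Fin 1, Fin.natAdd 0 i = i := by decide
  simp [evalForm_zero_eq, h]

theorem evalForm_smul_fun (a : S.Form 1) (f : S.Form 0) (x : S.Point)
    (u : Fin 1 → S.Tangent x) :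
    S.evalForm 1 (S.wedge 1 0 a f) x u = S.evalForm 0 f x Fin.elim0 * S.evalForm 1 a x u := by
  refine (S.evalForm_wedge 1 0 a f x u).trans ?_
  have h : ∀ i : Fin 1, Fin.castAdd 0 i = i := by decide
  simp [evalForm_zero_eq, h, mul_comm]

theorem contr_wedge_one_one (X : S.VF) (a b : S.Form 1) :
    S.contr 1 X (S.wedgeOne a b)
      = S.funSmul (S.contr 0 X a) b - S.funSmul (S.contr 0 X b) a := by
  refine form_ext fun x u => ?_
  rw [evalForm_contr, map_sub, Pi.sub_apply, AlternatingMap.sub_apply]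
  refine (S.evalForm_wedge 1 1 a b x _).trans ?_
  rw [evalForm_fun_smul, evalForm_fun_smul]
  rw [evalForm_contr, evalForm_contr]
  have hperm : (Finset.univ : Finset (Equiv.Perm (Fin (1+1)))) = {1, Equiv.swap 0 1} := by decide
  have hne : (1 : Equiv.Perm (Fin (1+1))) ≠ Equiv.swap 0 1 := by decide
  have hswap_right : ∀ i : Fin 1, Equiv.swap 0 1 (Fin.succ i) = 0 := by decide
  have hcast : ∀ i : Fin 1, Fin.castAdd 1 i = 0 := by decide
  have hcons : (Fin.cons (S.evalVF X x) Fin.elim0 : Fin 1 → S.Tangent x)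
      = fun _ => S.evalVF X x := by
    funext i
    obtain rfl : i = 0 := Subsingleton.elim (α := Fin 1) i 0
    rfl
  have hu : (fun _ => u 0) = u := by
    funext i
    rw [Subsingleton.elim i 0]
  rw [hperm, Finset.sum_pair hne, hcons]
  simp [hswap_right, hcast, hu]
  ring

theorem contr_fun_smul (X : S.VF) (f : S.Form 0) (a : S.Form 1) :
    S.contr 0 X (S.funSmul f a) = S.funMul f (S.contr 0 X a) := by
  refine form_ext fun x u => ?_
  rw [evalForm_contr]
  rw [evalForm_fun_smul, evalForm_fun_mul]
  rw [evalForm_contr, Subsingleton.elim u Fin.elim0]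

theorem d_fun_mul (f g : S.Form 0) :
    S.d 0 (S.funMul f g) = S.funSmul g (S.d 0 f) + S.funSmul f (S.d 0 g) := by
  have h : S.d 0 (S.funMul f g) = (S.wedge 1 0 (S.d 0 f) g : S.Form 1) + S.funSmul f (S.d 0 g) := by
    simpa [funMul, funSmul] using S.d_wedge 0 0 f g
  rw [h]
  congr 1
  refine form_ext fun x u => ?_
  rw [evalForm_fun_smul, evalForm_smul_fun]

theorem d_fun_smul_of_closed (f : S.Form 0) {a : S.Form 1} (ha : S.d 1 a = 0) :
    S.d 1 (S.funSmul f a) = S.wedgeOne (S.d 0 f) a := by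
  simpa [funSmul, wedgeOne, ha] using S.d_wedge 0 1 f a

theorem d_wedge_one_one_of_closed {a b : S.Form 1} (ha : S.d 1 a = 0) (hb : S.d 1 b = 0) :
    S.d 2 (S.wedgeOne a b) = 0 := by
  simpa [wedgeOne, ha, hb] using S.d_wedge 1 1 a b

/-- The failure of `ι_{[Y,Z]} = [L_Y, ι_Z]` on closed `1`-forms. -/
def cartanDefect (Y Z : S.VF) (a : S.Form 1) : S.Form 0 :=
  S.contr 0 (S.bracketVF Y Z) a - S.contr 0 Y (S.d 0 (S.contr 0 Z a))
    + S.contr 0 Z (S.d 0 (S.contr 0 Y a))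

/-- Both sides of Cartan's commutator identity being derivations, their difference on
`1`-forms is constrained by its vanishing on the `2`-form `a ∧ b`. -/
theorem cartanDefect_smul_comm (Y Z : S.VF) {a b : S.Form 1} (ha : S.d 1 a = 0)
    (hb : S.d 1 b = 0) (x : S.Point) (u : Fin 1 → S.Tangent x) :
    S.evalForm 0 (cartanDefect Y Z a) x Fin.elim0 * S.evalForm 1 b x u
      = S.evalForm 0 (cartanDefect Y Z b) x Fin.elim0 * S.evalForm 1 a x u := by
  have key : S.contr 1 (S.bracketVF Y Z) (S.wedgeOne a b)
      = S.d 0 (S.contr 0 Y (S.contr 1 Z (S.wedgeOne a b)))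
        + S.contr 1 Y (S.d 1 (S.contr 1 Z (S.wedgeOne a b)))
        - S.contr 1 Z (S.d 1 (S.contr 1 Y (S.wedgeOne a b))
            + S.contr 2 Y (S.d 2 (S.wedgeOne a b))) :=
    contr_bracketVF 0 Y Z (S.wedgeOne a b)
  rw [d_wedge_one_one_of_closed ha hb] at key
  simp only [contr_wedge_one_one, map_sub, map_zero, add_zero, contr_fun_smul, d_fun_mul,
    d_fun_smul_of_closed _ ha, d_fun_smul_of_closed _ hb] at key
  have h := congrArg (fun c : S.Form 1 => S.evalForm 1 c x u) key
  simp only [map_sub, map_add, Pi.sub_apply, Pi.add_apply, AlternatingMap.sub_apply,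
    AlternatingMap.add_apply, evalForm_fun_smul] at h
  simp only [cartanDefect, map_sub, map_add, Pi.sub_apply, Pi.add_apply, AlternatingMap.sub_apply,
    AlternatingMap.add_apply]
  linear_combination h

end LowDegree

section Hamiltonian

variable {S}

theorem d_contr_contr {m : ℕ} {ω : S.Form (m+2)} (hω : S.d (m+2) ω = 0) {X Y : S.VF}
    (hX : S.d (m+1) (S.contr (m+1) X ω) = 0) (hY : S.d (m+1) (S.contr (m+1) Y ω) = 0) :
    S.d m (S.contr m Y (S.contr (m+1) X ω)) = - S.contr (m+1) (S.bracketVF X Y) ω := by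
  rw [contr_bracketVF, hX, hY, hω, contr_contr_comm]
  simp

/-- The Jacobiator of the bracket of Hamiltonian forms, in terms of their Hamiltonian
vector fields. -/
def jacobiator (m : ℕ) (ω : S.Form (m+2)) (X Y Z : S.VF) : S.Form m :=
  S.contr m Z (S.contr (m+1) (S.bracketVF X Y) ω)
    + S.contr m X (S.contr (m+1) (S.bracketVF Y Z) ω)
    + S.contr m Y (S.contr (m+1) (S.bracketVF Z X) ω)

theorem jacobiator_rotate (m : ℕ) (ω : S.Form (m+2)) (X Y Z : S.VF) :
    jacobiator m ω X Y Z = jacobiator m ω Y Z X := by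
  simp only [jacobiator]
  abel

theorem cartanDefect_contr {ω : S.Form 2} (hω : S.d 2 ω = 0) {X Y Z : S.VF}
    (hX : S.d 1 (S.contr 1 X ω) = 0) (hY : S.d 1 (S.contr 1 Y ω) = 0)
    (hZ : S.d 1 (S.contr 1 Z ω) = 0) :
    cartanDefect Y Z (S.contr 1 X ω) = - jacobiator 0 ω X Y Z := by
  have hXY := d_contr_contr (m := 0) hω hX hY
  have hXZ := d_contr_contr (m := 0) hω hX hZ
  have hcomm := contr_contr_comm 0 (S.bracketVF Y Z) X ω
  simp only [cartanDefect, jacobiator, hXY, hXZ, hcomm, S.bracketVF_skew Z X, map_neg,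
    LinearMap.neg_apply]
  abel

theorem jacobiator_self_left {ω : S.Form 2} (hω : S.d 2 ω = 0) {Y : S.VF}
    (hY : S.d 1 (S.contr 1 Y ω) = 0) (Z : S.VF) : jacobiator 0 ω Y Y Z = 0 := by
  have hYY : S.contr 1 (S.bracketVF Y Y) ω = 0 := by
    have h := d_contr_contr (m := 0) hω hY hY
    rw [contr_contr_self, map_zero] at h
    exact neg_eq_zero.mp h.symm
  simp [jacobiator, hYY, S.bracketVF_skew Z Y]

theorem evalForm_jacobiator_mul {ω : S.Form 2} (hω : S.d 2 ω = 0) {X Y Z : S.VF}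
    (hX : S.d 1 (S.contr 1 X ω) = 0) (hY : S.d 1 (S.contr 1 Y ω) = 0)
    (hZ : S.d 1 (S.contr 1 Z ω) = 0) (x : S.Point) (u : Fin 1 → S.Tangent x) :
    S.evalForm 0 (jacobiator 0 ω X Y Z) x Fin.elim0 * S.evalForm 1 (S.contr 1 Y ω) x u = 0 := by
  have h := cartanDefect_smul_comm Y Z hX hY x u
  rw [cartanDefect_contr hω hX hY hZ, cartanDefect_contr hω hY hY hZ,
    jacobiator_self_left hω hY Z] at h
  simpa using h

theorem jacobiator_zero_eq_zero {ω : S.Form 2} (hω : S.IsPlectic 1 ω) {X Y Z : S.VF}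
    (hX : S.d 1 (S.contr 1 X ω) = 0) (hY : S.d 1 (S.contr 1 Y ω) = 0)
    (hZ : S.d 1 (S.contr 1 Z ω) = 0) : jacobiator 0 ω X Y Z = 0 := by
  refine form_ext fun x u => ?_
  rw [map_zero, Pi.zero_apply, AlternatingMap.zero_apply, evalForm_zero_eq]
  by_contra hne
  have vanish : ∀ V : S.VF, (∀ u, S.evalForm 0 (jacobiator 0 ω X Y Z) x Fin.elim0 *
      S.evalForm 1 (S.contr 1 V ω) x u = 0) → S.evalVF V x = 0 := fun V hV =>
    hω.2 x _ fun u => by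
      rw [← evalForm_contr]
      exact (mul_eq_zero.mp (hV u)).resolve_left hne
  have hYx := vanish Y (evalForm_jacobiator_mul hω.1 hX hY hZ x)
  have hZx := vanish Z fun u => by
    rw [jacobiator_rotate]
    exact evalForm_jacobiator_mul hω.1 hY hZ hX x u
  have hXx := vanish X fun u => by
    rw [← jacobiator_rotate]
    exact evalForm_jacobiator_mul hω.1 hZ hX hY x u
  apply hne
  simp [jacobiator, evalForm_contr_eq_zero hXx, evalForm_contr_eq_zero hYx,
    evalForm_contr_eq_zero hZx]

theorem jacobiator_succ {m : ℕ} {ω : S.Form (m+3)} (hω : S.d (m+3) ω = 0) {X Y Z : S.VF}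
    (hX : S.d (m+2) (S.contr (m+2) X ω) = 0) (hY : S.d (m+2) (S.contr (m+2) Y ω) = 0)
    (hZ : S.d (m+2) (S.contr (m+2) Z ω) = 0) :
    jacobiator (m+1) ω X Y Z
      = S.d m (S.contr m Z (S.contr (m+1) Y (S.contr (m+2) X ω))) := by
  have h := contr_bracketVF m Y Z (S.contr (m+2) X ω)
  rw [hX, d_contr_contr (m := m+1) hω hX hY, d_contr_contr (m := m+1) hω hX hZ,
    contr_contr_comm (m+1) _ X, contr_contr_comm m Y Z] at h
  simp only [map_neg, map_zero, add_zero, sub_neg_eq_add] at h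
  rw [jacobiator, neg_eq_iff_eq_neg.mp h, S.bracketVF_skew Z X]
  simp only [map_neg, LinearMap.neg_apply]
  abel

theorem jacobiator_mem_exactSubmodule {m : ℕ} {ω : S.Form (m+2)} (hω : S.IsPlectic (m+1) ω)
    {X Y Z : S.VF} (hX : S.d (m+1) (S.contr (m+1) X ω) = 0)
    (hY : S.d (m+1) (S.contr (m+1) Y ω) = 0) (hZ : S.d (m+1) (S.contr (m+1) Z ω) = 0) :
    jacobiator m ω X Y Z ∈ S.exactSubmodule m := by
  cases m with
  | zero =>
    rw [show jacobiator 0 ω X Y Z = 0 from jacobiator_zero_eq_zero hω hX hY hZ]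
    exact zero_mem _
  | succ m => exact ⟨_, (jacobiator_succ hω.1 hX hY hZ).symm⟩

theorem d_eq_zero_of_mem_exactSubmodule {m : ℕ} {α : S.Form m} (h : α ∈ S.exactSubmodule m) :
    S.d m α = 0 := by
  obtain ⟨γ, rfl⟩ := h
  cases m with
  | zero => simp [dLow]
  | succ m => exact S.d_d m γ

theorem contr_injective {n : ℕ} {ω : S.Form (n+1)} (hω : S.IsPlectic n ω) {X Y : S.VF}
    (h : S.contr n X ω = S.contr n Y ω) : X = Y := by
  rw [← sub_eq_zero]
  refine S.evalVF_injective (funext fun x => ?_)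
  rw [map_zero, Pi.zero_apply]
  refine hω.2 x _ fun u => ?_
  rw [← evalForm_contr, map_sub, LinearMap.sub_apply, h]
  simp

theorem IsHamPair.contr_eq {m : ℕ} {ω : S.Form (m+2)} {α : S.Form m} {X : S.VF}
    (h : S.IsHamPair m ω α X) : S.contr (m+1) X ω = - S.d m α :=
  (neg_eq_iff_eq_neg.mpr h).symm

theorem IsHamPair.closed {m : ℕ} {ω : S.Form (m+2)} {α : S.Form m} {X : S.VF}
    (h : S.IsHamPair m ω α X) : S.d (m+1) (S.contr (m+1) X ω) = 0 := by
  rw [h.contr_eq, map_neg, S.d_d, neg_zero]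

theorem IsHamPair.hamBracket {m : ℕ} {ω : S.Form (m+2)} (hω : S.d (m+2) ω = 0)
    {α β : S.Form m} {X Y : S.VF} (hX : S.IsHamPair m ω α X) (hY : S.IsHamPair m ω β Y) :
    S.IsHamPair m ω (S.hamBracket m ω X Y) (S.bracketVF X Y) :=
  d_contr_contr hω hX.closed hY.closed

theorem isHamPair_zero_of_closed {m : ℕ} (ω : S.Form (m+2)) {α : S.Form m} (h : S.d m α = 0) :
    S.IsHamPair m ω α 0 := by
  simp [IsHamPair, h]

theorem IsHamPair.unique {m : ℕ} {ω : S.Form (m+2)} (hω : S.IsPlectic (m+1) ω) {α : S.Form m}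
    {X Y : S.VF} (hX : S.IsHamPair m ω α X) (hY : S.IsHamPair m ω α Y) : X = Y :=
  contr_injective hω (hX.contr_eq.trans hY.contr_eq.symm)

/-- The linear map sending a Hamiltonian form to its Hamiltonian vector field. -/
noncomputable def hamField {m : ℕ} {ω : S.Form (m+2)} (hω : S.IsPlectic (m+1) ω) :
    S.hamSubmodule m ω →ₗ[ℝ] S.VF where
  toFun α := Classical.choose α.2
  map_add' α β := contr_injective hω <| by
    rw [IsHamPair.contr_eq (Classical.choose_spec (α + β).2), map_add, LinearMap.add_apply,
      IsHamPair.contr_eq (Classical.choose_spec α.2),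
      IsHamPair.contr_eq (Classical.choose_spec β.2), Submodule.coe_add, map_add, neg_add]
  map_smul' c α := contr_injective hω <| by
    rw [IsHamPair.contr_eq (Classical.choose_spec (c • α).2), RingHom.id_apply, map_smul,
      LinearMap.smul_apply, IsHamPair.contr_eq (Classical.choose_spec α.2),
      Submodule.coe_smul, map_smul, smul_neg]

theorem isHamPair_hamField {m : ℕ} {ω : S.Form (m+2)} (hω : S.IsPlectic (m+1) ω)
    (α : S.hamSubmodule m ω) : S.IsHamPair m ω α (hamField hω α) :=
  Classical.choose_spec α.2

theorem hamField_eq {m : ℕ} {ω : S.Form (m+2)} (hω : S.IsPlectic (m+1) ω)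
    {α : S.hamSubmodule m ω} {X : S.VF} (h : S.IsHamPair m ω α X) : hamField hω α = X :=
  (isHamPair_hamField hω α).unique hω h

/-- The bracket of Hamiltonian forms, as a bilinear map. -/
noncomputable def hamBracketLin {m : ℕ} {ω : S.Form (m+2)} (hω : S.IsPlectic (m+1) ω) :
    S.hamSubmodule m ω →ₗ[ℝ] S.hamSubmodule m ω →ₗ[ℝ] S.hamSubmodule m ω :=
  LinearMap.mk₂ ℝ
    (fun α β => ⟨S.hamBracket m ω (hamField hω α) (hamField hω β), _,
      (isHamPair_hamField hω α).hamBracket hω.1 (isHamPair_hamField hω β)⟩)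
    (fun α α' β => Subtype.ext <| by simp [CartanCalculus.hamBracket])
    (fun c α β => Subtype.ext <| by simp [CartanCalculus.hamBracket])
    (fun α β β' => Subtype.ext <| by simp [CartanCalculus.hamBracket])
    (fun c α β => Subtype.ext <| by simp [CartanCalculus.hamBracket])

theorem coe_hamBracketLin {m : ℕ} {ω : S.Form (m+2)} (hω : S.IsPlectic (m+1) ω)
    (α β : S.hamSubmodule m ω) :
    (hamBracketLin hω α β : S.Form m)
      = S.contr m (hamField hω β) (S.contr (m+1) (hamField hω α) ω) :=
  rfl

theorem hamField_hamBracketLin {m : ℕ} {ω : S.Form (m+2)} (hω : S.IsPlectic (m+1) ω)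
    (α β : S.hamSubmodule m ω) :
    hamField hω (hamBracketLin hω α β) = S.bracketVF (hamField hω α) (hamField hω β) :=
  hamField_eq hω ((isHamPair_hamField hω α).hamBracket hω.1 (isHamPair_hamField hω β))

theorem hamField_eq_zero_of_exact {m : ℕ} {ω : S.Form (m+2)} (hω : S.IsPlectic (m+1) ω)
    {α : S.hamSubmodule m ω} (h : (α : S.Form m) ∈ S.exactSubmodule m) : hamField hω α = 0 :=
  hamField_eq hω (isHamPair_zero_of_closed ω (d_eq_zero_of_mem_exactSubmodule h))

theorem hamBracketLin_skew {m : ℕ} {ω : S.Form (m+2)} (hω : S.IsPlectic (m+1) ω)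
    (α β : S.hamSubmodule m ω) : hamBracketLin hω α β = - hamBracketLin hω β α :=
  Subtype.ext (contr_contr_comm m _ _ ω)

theorem hamBracketLin_jacobi {m : ℕ} {ω : S.Form (m+2)} (hω : S.IsPlectic (m+1) ω)
    (α β γ : S.hamSubmodule m ω) :
    ((hamBracketLin hω (hamBracketLin hω α β) γ
      - (hamBracketLin hω α (hamBracketLin hω β γ) - hamBracketLin hω β (hamBracketLin hω α γ)) :
        S.hamSubmodule m ω) : S.Form m) ∈ S.exactSubmodule m := by
  convert jacobiator_mem_exactSubmodule hω (isHamPair_hamField hω α).closed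
    (isHamPair_hamField hω β).closed (isHamPair_hamField hω γ).closed using 1
  rw [hamBracketLin_skew hω α (hamBracketLin hω β γ),
    hamBracketLin_skew hω β (hamBracketLin hω α γ)]
  simp only [AddSubgroupClass.coe_sub, NegMemClass.coe_neg, coe_hamBracketLin,
    hamField_hamBracketLin, jacobiator,
    S.bracketVF_skew (hamField hω γ) (hamField hω α), map_neg, LinearMap.neg_apply]
  abel

/-- The bracket induced on Hamiltonian forms modulo exact forms. -/
noncomputable def quotientBracket {m : ℕ} {ω : S.Form (m+2)} (hω : S.IsPlectic (m+1) ω) :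
    (S.hamSubmodule m ω ⧸ (S.exactSubmodule m).comap (S.hamSubmodule m ω).subtype) →ₗ[ℝ]
      (S.hamSubmodule m ω ⧸ (S.exactSubmodule m).comap (S.hamSubmodule m ω).subtype) →ₗ[ℝ]
      (S.hamSubmodule m ω ⧸ (S.exactSubmodule m).comap (S.hamSubmodule m ω).subtype) :=
  Submodule.liftQ _
    { toFun := fun α => Submodule.mapQ _ _ (hamBracketLin hω α) fun β hβ => by
        have h0 : hamBracketLin hω α β = 0 := Subtype.ext <| by
          rw [coe_hamBracketLin, hamField_eq_zero_of_exact hω hβ]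
          simp
        rw [Submodule.mem_comap, h0]
        exact zero_mem _
      map_add' := fun α α' => by
        ext β
        simp
      map_smul' := fun c α => by
        ext β
        simp }
    fun α hα => by
      rw [LinearMap.mem_ker]
      ext β
      have h0 : hamBracketLin hω α β = 0 := Subtype.ext <| by
        rw [coe_hamBracketLin, hamField_eq_zero_of_exact hω hα]
        simp
      simp [h0]

theorem quotientBracket_mk {m : ℕ} {ω : S.Form (m+2)} (hω : S.IsPlectic (m+1) ω)
    (α β : S.hamSubmodule m ω) :
    quotientBracket hω (Submodule.Quotient.mk α) (Submodule.Quotient.mk β)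
      = Submodule.Quotient.mk (hamBracketLin hω α β) :=
  rfl

end Hamiltonian


/-- Let `(M, ω)` be an `n`-plectic manifold (here `n = m + 1`).  The
bracket `{α, β} = ι_{v_β} ι_{v_α} ω` on Hamiltonian `(n-1)`-forms induces a
well-defined skew-symmetric bracket `{·,·}'` on the quotient vector space
`𝔤 = Ham^{n-1}(M) / dΩ^{n-2}(M)` of Hamiltonian `(n-1)`-forms modulo exact
`(n-1)`-forms, and `(𝔤, {·,·}')` is a Lie algebra (the induced bracket satisfies the
Jacobi identity). -/
theorem quotient_bracket_lie_algebra
    (m : ℕ) (ω : S.Form (m+2)) (hω : S.IsPlectic (m+1) ω) :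
    ∃ br : (↥(S.hamSubmodule m ω) ⧸
              (S.exactSubmodule m).comap (S.hamSubmodule m ω).subtype) →ₗ[ℝ]
           (↥(S.hamSubmodule m ω) ⧸
              (S.exactSubmodule m).comap (S.hamSubmodule m ω).subtype) →ₗ[ℝ]
           (↥(S.hamSubmodule m ω) ⧸
              (S.exactSubmodule m).comap (S.hamSubmodule m ω).subtype),
      -- `br` is induced by the bracket of Hamiltonian forms …
      (∀ (α β : ↥(S.hamSubmodule m ω)) (X Y : S.VF),
        S.IsHamPair m ω α.1 X → S.IsHamPair m ω β.1 Y →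
        ∀ hmem : S.hamBracket m ω X Y ∈ S.hamSubmodule m ω,
          br (Submodule.Quotient.mk α) (Submodule.Quotient.mk β)
            = Submodule.Quotient.mk (⟨S.hamBracket m ω X Y, hmem⟩ :
                ↥(S.hamSubmodule m ω))) ∧
      -- … uniquely (well-definedness), …
      (∀ br' : (↥(S.hamSubmodule m ω) ⧸
                  (S.exactSubmodule m).comap (S.hamSubmodule m ω).subtype) →ₗ[ℝ]
               (↥(S.hamSubmodule m ω) ⧸
                  (S.exactSubmodule m).comap (S.hamSubmodule m ω).subtype) →ₗ[ℝ]
               (↥(S.hamSubmodule m ω) ⧸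
                  (S.exactSubmodule m).comap (S.hamSubmodule m ω).subtype),
        (∀ (α β : ↥(S.hamSubmodule m ω)) (X Y : S.VF),
          S.IsHamPair m ω α.1 X → S.IsHamPair m ω β.1 Y →
          ∀ hmem : S.hamBracket m ω X Y ∈ S.hamSubmodule m ω,
            br' (Submodule.Quotient.mk α) (Submodule.Quotient.mk β)
              = Submodule.Quotient.mk (⟨S.hamBracket m ω X Y, hmem⟩ :
                  ↥(S.hamSubmodule m ω))) → br' = br) ∧
      -- … it is skew-symmetric, …
      (∀ a b, br a b = - br b a) ∧
      -- … and it satisfies the Jacobi identity.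
      (∀ a b c, br (br a b) c = br a (br b c) - br b (br a c)) := by
  refine ⟨quotientBracket hω, ?_, ?_, ?_, ?_⟩
  · intro α β X Y hX hY hmem
    obtain rfl := hamField_eq hω hX
    obtain rfl := hamField_eq hω hY
    rfl
  · intro br' h
    refine LinearMap.ext fun a => LinearMap.ext fun b => ?_
    induction a using Submodule.Quotient.induction_on with | _ α
    induction b using Submodule.Quotient.induction_on with | _ β
    rw [quotientBracket_mk]
    exact h α β _ _ (isHamPair_hamField hω α) (isHamPair_hamField hω β) _
  · intro a b
    induction a using Submodule.Quotient.induction_on with | _ α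
    induction b using Submodule.Quotient.induction_on with | _ β
    rw [quotientBracket_mk, quotientBracket_mk, hamBracketLin_skew, Submodule.Quotient.mk_neg]
  · intro a b c
    induction a using Submodule.Quotient.induction_on with | _ α
    induction b using Submodule.Quotient.induction_on with | _ β
    induction c using Submodule.Quotient.induction_on with | _ γ
    simp only [quotientBracket_mk]
    rw [← Submodule.Quotient.mk_sub, Submodule.Quotient.eq]
    exact hamBracketLin_jacobi hω α β γ

end CartanCalculus
end
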